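/- Soundness of RS4: if a hypersequent H is derivable in the calculus RS4 (RK extended with the rules EC and EW), then no Kripke model whose accessibility relation is reflexive and transitive is a counter-example to H. -/

import Mathlib

/-- Modal formulas: atoms, negation, conjunction, box. -/
inductive MF : Type
  | atom : ℕ → MF
  | neg : MF → MF
  | conj : MF → MF → MF
  | box : MF → MF

/-- A sequent: a pair of finite multisets of modal formulas. -/
structure Seqt : Type where
  ant : Multiset MF
  suc : Multiset MF

/-- The empty sequent. -/
def Seqt.empty : Seqt := ⟨0, 0⟩

/-- A hypersequent: a (nonempty, enforced in theorems) sequence of sequents. -/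
abbrev Hyperseq := List Seqt

/-- A Kripke model. -/
structure KModel : Type 1 where
  W : Type
  R : W → W → Prop
  V : ℕ → W → Prop

/-- Satisfaction of a modal formula at a world. -/
def KModel.sat (M : KModel) : M.W → MF → Prop
  | w, .atom n => M.V n w
  | w, .neg φ => ¬ M.sat w φ
  | w, .conj φ ψ => M.sat w φ ∧ M.sat w ψ
  | w, .box φ => ∀ v, M.R w v → M.sat v φ

/-- `M` is a countermodel to sequent `S` at world `w`. -/
def Countermodel (M : KModel) (w : M.W) (S : Seqt) : Prop :=
  (∀ φ ∈ S.ant, M.sat w φ) ∧ (∀ φ ∈ S.suc, ¬ M.sat w φ)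

/-- `M` is a counter-example to hypersequent `H`: there is a branch of worlds
(consecutive worlds related by `R`) falsifying the components pointwise. -/
def CounterExample (M : KModel) (H : Hyperseq) : Prop :=
  ∃ ws : List M.W, List.Chain' M.R ws ∧
    List.Forall₂ (fun S w => Countermodel M w S) H ws

/-- Which optional rules are present in a calculus (RK rules are always present). -/
structure RuleSet : Type where
  cut : Bool := false
  ec : Bool := false
  ew : Bool := false
  ee : Bool := false
  drop : Bool := false
  sym : Bool := false

/-- Derivability in a relational hypersequent calculus: the rules of RK
(axioms, internal weakening/contraction, EWL/EWR, rules for ¬, ∧, □),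
plus cut and the external structural rules EC, EW, EE, Drop, Sym when enabled. -/
inductive Deriv (ρ : RuleSet) : Hyperseq → Prop
  | ax (φ : MF) : Deriv ρ [⟨{φ}, {φ}⟩]
  | wl (G H : Hyperseq) (Γ Δ : Multiset MF) (φ : MF) :
      Deriv ρ (G ++ ⟨Γ, Δ⟩ :: H) → Deriv ρ (G ++ ⟨φ ::ₘ Γ, Δ⟩ :: H)
  | wr (G H : Hyperseq) (Γ Δ : Multiset MF) (φ : MF) :
      Deriv ρ (G ++ ⟨Γ, Δ⟩ :: H) → Deriv ρ (G ++ ⟨Γ, φ ::ₘ Δ⟩ :: H)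
  | cl (G H : Hyperseq) (Γ Δ : Multiset MF) (φ : MF) :
      Deriv ρ (G ++ ⟨φ ::ₘ φ ::ₘ Γ, Δ⟩ :: H) → Deriv ρ (G ++ ⟨φ ::ₘ Γ, Δ⟩ :: H)
  | cr (G H : Hyperseq) (Γ Δ : Multiset MF) (φ : MF) :
      Deriv ρ (G ++ ⟨Γ, φ ::ₘ φ ::ₘ Δ⟩ :: H) → Deriv ρ (G ++ ⟨Γ, φ ::ₘ Δ⟩ :: H)
  | cut (hρ : ρ.cut = true) (G H : Hyperseq) (Γ Δ Λ Θ : Multiset MF) (φ : MF) :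
      Deriv ρ (G ++ ⟨Γ, φ ::ₘ Δ⟩ :: H) → Deriv ρ (G ++ ⟨φ ::ₘ Λ, Θ⟩ :: H) →
      Deriv ρ (G ++ ⟨Γ + Λ, Δ + Θ⟩ :: H)
  | ewr (G : Hyperseq) : Deriv ρ G → Deriv ρ (G ++ [Seqt.empty])
  | ewl (G : Hyperseq) : Deriv ρ G → Deriv ρ (Seqt.empty :: G)
  | negL (G H : Hyperseq) (Γ Δ : Multiset MF) (φ : MF) :
      Deriv ρ (G ++ ⟨Γ, φ ::ₘ Δ⟩ :: H) → Deriv ρ (G ++ ⟨.neg φ ::ₘ Γ, Δ⟩ :: H)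
  | negR (G H : Hyperseq) (Γ Δ : Multiset MF) (φ : MF) :
      Deriv ρ (G ++ ⟨φ ::ₘ Γ, Δ⟩ :: H) → Deriv ρ (G ++ ⟨Γ, .neg φ ::ₘ Δ⟩ :: H)
  | andL1 (G H : Hyperseq) (Γ Δ : Multiset MF) (φ ψ : MF) :
      Deriv ρ (G ++ ⟨φ ::ₘ Γ, Δ⟩ :: H) → Deriv ρ (G ++ ⟨.conj φ ψ ::ₘ Γ, Δ⟩ :: H)
  | andL2 (G H : Hyperseq) (Γ Δ : Multiset MF) (φ ψ : MF) :
      Deriv ρ (G ++ ⟨ψ ::ₘ Γ, Δ⟩ :: H) → Deriv ρ (G ++ ⟨.conj φ ψ ::ₘ Γ, Δ⟩ :: H)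
  | andR (G H : Hyperseq) (Γ Δ : Multiset MF) (φ ψ : MF) :
      Deriv ρ (G ++ ⟨Γ, φ ::ₘ Δ⟩ :: H) → Deriv ρ (G ++ ⟨Γ, ψ ::ₘ Δ⟩ :: H) →
      Deriv ρ (G ++ ⟨Γ, .conj φ ψ ::ₘ Δ⟩ :: H)
  | boxL (G H : Hyperseq) (Γ Δ Λ Θ : Multiset MF) (φ : MF) :
      Deriv ρ (G ++ ⟨Γ, Δ⟩ :: ⟨φ ::ₘ Λ, Θ⟩ :: H) →
      Deriv ρ (G ++ ⟨.box φ ::ₘ Γ, Δ⟩ :: ⟨Λ, Θ⟩ :: H)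
  | boxR (G : Hyperseq) (Γ Δ : Multiset MF) (φ : MF) :
      Deriv ρ (G ++ [⟨Γ, Δ⟩, ⟨0, {φ}⟩]) → Deriv ρ (G ++ [⟨Γ, .box φ ::ₘ Δ⟩])
  | ec (hρ : ρ.ec = true) (G H : Hyperseq) (S : Seqt) :
      Deriv ρ (G ++ S :: S :: H) → Deriv ρ (G ++ S :: H)
  | ew (hρ : ρ.ew = true) (G H : Hyperseq) :
      Deriv ρ (G ++ H) → Deriv ρ (G ++ Seqt.empty :: H)
  | ee (hρ : ρ.ee = true) (G H : Hyperseq) (S S' : Seqt) :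
      Deriv ρ (G ++ S :: S' :: H) → Deriv ρ (G ++ S' :: S :: H)
  | drop (hρ : ρ.drop = true) (G : Hyperseq) :
      Deriv ρ (G ++ [Seqt.empty]) → Deriv ρ G
  | symm (hρ : ρ.sym = true) (G : Hyperseq) : Deriv ρ G → Deriv ρ G.reverse

/-- The calculus RS4 = RK + EC + EW (with cut). -/
def RS4 : RuleSet := { cut := true, ec := true, ew := true }

theorem List.forall₂_append_left_iff {α β : Type*} {r : α → β → Prop} {l₁ l₂ : List α}
    {u : List β} :
    List.Forall₂ r (l₁ ++ l₂) u ↔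
      ∃ u₁ u₂, u = u₁ ++ u₂ ∧ List.Forall₂ r l₁ u₁ ∧ List.Forall₂ r l₂ u₂ := by
  constructor
  · intro h
    exact ⟨_, _, (List.take_append_drop l₁.length u).symm,
      (List.forall₂_take_append _ _ _ h.flip).flip, (List.forall₂_drop_append _ _ _ h.flip).flip⟩
  · rintro ⟨u₁, u₂, rfl, h₁, h₂⟩
    exact List.rel_append h₁ h₂

/-- A counter-example splits along a concatenation of hypersequents. -/
theorem counterExample_append_iff {M : KModel} {G H : Hyperseq} :
    CounterExample M (G ++ H) ↔
      ∃ us vs : List M.W, List.IsChain M.R (us ++ vs) ∧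
        List.Forall₂ (fun S w => Countermodel M w S) G us ∧
        List.Forall₂ (fun S w => Countermodel M w S) H vs := by
  constructor
  · rintro ⟨ws, hc, hf⟩
    obtain ⟨us, vs, rfl, hu, hv⟩ := List.forall₂_append_left_iff.1 hf
    exact ⟨us, vs, hc, hu, hv⟩
  · rintro ⟨us, vs, hc, hu, hv⟩
    exact ⟨us ++ vs, hc, List.rel_append hu hv⟩

/-- A counter-example splits around a distinguished component. -/
theorem counterExample_append_cons_iff {M : KModel} {G H : Hyperseq} {S : Seqt} :
    CounterExample M (G ++ S :: H) ↔
      ∃ (us : List M.W) (w : M.W) (vs : List M.W), List.IsChain M.R (us ++ w :: vs) ∧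
        List.Forall₂ (fun S w => Countermodel M w S) G us ∧ Countermodel M w S ∧
        List.Forall₂ (fun S w => Countermodel M w S) H vs := by
  rw [counterExample_append_iff]
  constructor
  · rintro ⟨us, _, hc, hu, hv⟩
    cases hv with
    | cons hw hv => exact ⟨us, _, _, hc, hu, hw, hv⟩
  · rintro ⟨us, w, vs, hc, hu, hw, hv⟩
    exact ⟨us, w :: vs, hc, hu, .cons hw hv⟩

/-- A counter-example survives replacing a component by one that is falsified wherever it is. -/
theorem CounterExample.replace {M : KModel} {G H : Hyperseq} {S S' : Seqt}
    (h : CounterExample M (G ++ S :: H))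
    (hS : ∀ w, Countermodel M w S → Countermodel M w S') :
    CounterExample M (G ++ S' :: H) := by
  obtain ⟨us, w, vs, hc, hu, hw, hv⟩ := counterExample_append_cons_iff.1 h
  exact counterExample_append_cons_iff.2 ⟨us, w, vs, hc, hu, hS w hw, hv⟩

/-- If every world falsifying `S` falsifies one of `S₁`, `S₂`, then a counter-example for `S`
in context is one for `S₁` or for `S₂`. -/
theorem CounterExample.replace_or {M : KModel} {G H : Hyperseq} {S S₁ S₂ : Seqt}
    (h : CounterExample M (G ++ S :: H))
    (hS : ∀ w, Countermodel M w S → Countermodel M w S₁ ∨ Countermodel M w S₂) :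
    CounterExample M (G ++ S₁ :: H) ∨ CounterExample M (G ++ S₂ :: H) := by
  obtain ⟨us, w, vs, hc, hu, hw, hv⟩ := counterExample_append_cons_iff.1 h
  exact (hS w hw).imp
    (fun hw => counterExample_append_cons_iff.2 ⟨us, w, vs, hc, hu, hw, hv⟩)
    (fun hw => counterExample_append_cons_iff.2 ⟨us, w, vs, hc, hu, hw, hv⟩)

/-- In a transitive model, deleting a component preserves counter-examples. -/
theorem CounterExample.delete {M : KModel} [IsTrans M.W M.R] {G H : Hyperseq} {S : Seqt}
    (h : CounterExample M (G ++ S :: H)) : CounterExample M (G ++ H) := by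
  obtain ⟨us, w, vs, hc, hu, -, hv⟩ := counterExample_append_cons_iff.1 h
  exact counterExample_append_iff.2
    ⟨us, vs, hc.sublist ((List.sublist_cons_self w vs).append_left us), hu, hv⟩

/-- In a reflexive model, duplicating a component preserves counter-examples. -/
theorem CounterExample.duplicate {M : KModel} [Std.Refl M.R] {G H : Hyperseq} {S : Seqt}
    (h : CounterExample M (G ++ S :: H)) : CounterExample M (G ++ S :: S :: H) := by
  obtain ⟨us, w, vs, hc, hu, hw, hv⟩ := counterExample_append_cons_iff.1 h
  obtain ⟨hl, hr⟩ := List.isChain_split.1 hc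
  exact counterExample_append_cons_iff.2 ⟨us, w, w :: vs,
    List.isChain_append_cons_cons.2 ⟨hl, refl w, hr⟩, hu, hw, .cons hw hv⟩

theorem CounterExample.of_boxL {M : KModel} {G H : Hyperseq} {Γ Δ Λ Θ : Multiset MF} {φ : MF}
    (h : CounterExample M (G ++ ⟨.box φ ::ₘ Γ, Δ⟩ :: ⟨Λ, Θ⟩ :: H)) :
    CounterExample M (G ++ ⟨Γ, Δ⟩ :: ⟨φ ::ₘ Λ, Θ⟩ :: H) := by
  obtain ⟨us, w, _, hc, hu, hw, hv⟩ := counterExample_append_cons_iff.1 h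
  cases hv with
  | cons hv hvs =>
    have hR := (List.isChain_append_cons_cons.1 hc).2.1
    simp only [Countermodel, Multiset.forall_mem_cons] at hw hv
    refine counterExample_append_cons_iff.2 ⟨us, w, _, hc, hu, ⟨hw.1.2, hw.2⟩, .cons ?_ hvs⟩
    exact ⟨Multiset.forall_mem_cons.2 ⟨hw.1.1 _ hR, hv.1⟩, hv.2⟩

theorem CounterExample.of_boxR {M : KModel} {G : Hyperseq} {Γ Δ : Multiset MF} {φ : MF}
    (h : CounterExample M (G ++ [⟨Γ, .box φ ::ₘ Δ⟩])) :
    CounterExample M (G ++ [⟨Γ, Δ⟩, ⟨0, {φ}⟩]) := by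
  obtain ⟨us, w, _, hc, hu, hw, hv⟩ := counterExample_append_cons_iff.1 h
  cases hv
  simp only [Countermodel, Multiset.forall_mem_cons, KModel.sat, not_forall] at hw
  obtain ⟨v, hR, hv⟩ := hw.2.1
  exact counterExample_append_cons_iff.2 ⟨us, w, [v],
    List.isChain_append_cons_cons.2 ⟨hc, hR, .singleton v⟩, hu, ⟨hw.1, hw.2.2⟩,
    .cons (by simpa [Countermodel] using hv) .nil⟩

/-- Soundness of RS4: derivable hypersequents have no counter-example in any
Kripke model with reflexive and transitive accessibility relation. -/
theorem RS4_soundness (H : Hyperseq) (hH : Deriv RS4 H) (M : KModel)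
    (hrefl : Reflexive M.R) (htrans : Transitive M.R) : ¬ CounterExample M H := by
  have : Std.Refl M.R := ⟨hrefl⟩
  have : IsTrans M.W M.R := ⟨htrans⟩
  induction hH with
  | ax φ =>
    rintro ⟨_, -, hf⟩
    cases hf with
    | cons hw _ => exact hw.2 φ (by simp) (hw.1 φ (by simp))
  | wl G H Γ Δ φ _ ih | wr G H Γ Δ φ _ ih | cl G H Γ Δ φ _ ih | cr G H Γ Δ φ _ ih
  | negL G H Γ Δ φ _ ih | negR G H Γ Δ φ _ ih
  | andL1 G H Γ Δ φ ψ _ ih | andL2 G H Γ Δ φ ψ _ ih =>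
    refine fun h => ih (h.replace fun w hw => ?_)
    simp only [Countermodel, Multiset.forall_mem_cons, KModel.sat] at hw ⊢
    tauto
  | cut _ G H Γ Δ Λ Θ φ _ _ ih₁ ih₂ =>
    refine fun h => (h.replace_or fun w hw => ?_).elim ih₁ ih₂
    simp only [Countermodel, Multiset.forall_mem_cons, Multiset.mem_add, or_imp,
      forall_and] at hw ⊢
    tauto
  | andR G H Γ Δ φ ψ _ _ ih₁ ih₂ =>
    refine fun h => (h.replace_or fun w hw => ?_).elim ih₁ ih₂
    simp only [Countermodel, Multiset.forall_mem_cons, KModel.sat] at hw ⊢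
    tauto
  | ewr G _ ih => exact fun h => ih (by simpa using h.delete)
  | ewl G _ ih => exact fun h => ih (CounterExample.delete (G := []) h)
  | boxL G H Γ Δ Λ Θ φ _ ih => exact fun h => ih h.of_boxL
  | boxR G Γ Δ φ _ ih => exact fun h => ih h.of_boxR
  | ec _ G H S _ ih => exact fun h => ih h.duplicate
  | ew _ G H _ ih => exact fun h => ih h.delete
  | ee hρ | drop hρ | symm hρ => cases hρ
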